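/- For every real number ℓ with ℓ ≥ log((1+√5)/2), there exists an irrational real number α with L(α) = ℓ such that α is either a quadratic irrational (its sequence of partial quotients is ultimately periodic) or a Sturmian continued fraction (its sequence of partial quotients is a Sturmian word). -/

import Mathlib

open Filter Real Matrix

noncomputable section

/-- `contQ w n` is the denominator `Q n` of the `n`-th convergent of the
continued fraction `[0; w 1, w 2, …]`. -/
def contQ (w : ℕ → ℕ) : ℕ → ℕ
  | 0 => 1
  | 1 => w 1
  | n + 2 => w (n + 2) * contQ w (n + 1) + contQ w n

/-- The real number `[0; w 1, w 2, …]` has Lévy constant `ℓ`, i.e. the sequence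
`(log Q n)/n` converges to `ℓ`. -/
def HasLevyConstant (w : ℕ → ℕ) (ℓ : ℝ) : Prop :=
  Tendsto (fun n : ℕ => Real.log (contQ w n) / n) atTop (nhds ℓ)

/-- `L` is a (finite) factor of the infinite word `w = w 1 w 2 ⋯`. -/
def IsFactorSeq (w : ℕ → ℕ) (L : List ℕ) : Prop :=
  ∃ i : ℕ, L = (List.range L.length).map fun j => w (i + j + 1)

/-- The complexity function `p(n, w)`: the number of distinct factors of length `n`. -/
def complexity (w : ℕ → ℕ) (n : ℕ) : ℕ :=
  Set.ncard {L : List ℕ | L.length = n ∧ IsFactorSeq w L}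

/-- The mechanical word `s_{θ,ρ}` over `{a,b}` (floor version), indexed from `1`. -/
def mechWord (a b : ℕ) (θ ρ : ℝ) (n : ℕ) : ℕ :=
  if ⌊(n : ℝ) * θ + ρ⌋ - ⌊((n : ℝ) - 1) * θ + ρ⌋ = 0 then a else b

/-- The mechanical word `s'_{θ,ρ}` over `{a,b}` (ceiling version), indexed from `1`. -/
def mechWord' (a b : ℕ) (θ ρ : ℝ) (n : ℕ) : ℕ :=
  if ⌈(n : ℝ) * θ + ρ⌉ - ⌈((n : ℝ) - 1) * θ + ρ⌉ = 0 then a else b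

/-- `w` is a Sturmian word over `{a, b}`: a mechanical word with irrational slope. -/
def IsSturmianWord (a b : ℕ) (w : ℕ → ℕ) : Prop :=
  ∃ θ ρ : ℝ, Irrational θ ∧ θ ∈ Set.Icc (0 : ℝ) 1 ∧ ρ ∈ Set.Ico (0 : ℝ) 1 ∧
    (w = mechWord a b θ ρ ∨ w = mechWord' a b θ ρ)

/-- The matrix `[[x, 1], [1, 0]]`. -/
def cfMat (x : ℝ) : Matrix (Fin 2) (Fin 2) ℝ := !![x, 1; 1, 0]

/-- `T(b₁, …, b_n)`: the trace of `[[b₁,1],[1,0]] ⋯ [[b_n,1],[1,0]]` for a word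
`b₁ ⋯ b_n` over the positive integers.  The trace of the empty word is `2`. -/
def traceWord (L : List ℕ) : ℝ := ((L.map fun c => cfMat (c : ℝ)).prod).trace

/-- The polynomial `𝐓_n(x) = Tr([[x,1],[1,0]]^n)`. -/
def Tpoly (n : ℕ) (x : ℝ) : ℝ := ((cfMat x) ^ n).trace

/-- The lower Christoffel word `w_{p/q}` over `{a, b}`: the prefix of length `q`
of the mechanical word `s_{p/q, 0}`. -/
def christoffel (a b p q : ℕ) : List ℕ :=
  (List.range q).map fun n => mechWord a b ((p : ℝ) / (q : ℝ)) 0 (n + 1)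

/-- `T(w_{p/q})`, the trace attached to the lower Christoffel word of slope `p/q`. -/
def Tw (a b p q : ℕ) : ℝ := traceWord (christoffel a b p q)

/-- The continuant `K(b₁, …, b_n)`: the denominator of `[0; b₁, …, b_n]`. -/
def contList : List ℕ → ℕ
  | [] => 1
  | [x] => x
  | x :: y :: t => x * contList (y :: t) + contList t

/-- The standard words attached to `d₁, d₂, …` : `sturmM a b d (k+1)` is the word
`M_k`, where `M_{-1} = b`, `M_0 = a` and `M_k = M_{k-1}^{d_k} M_{k-2}`. -/
def sturmM (a b : ℕ) (d : ℕ → ℕ) : ℕ → List ℕ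
  | 0 => [b]
  | 1 => [a]
  | k + 2 => (List.replicate (d (k + 1)) (sturmM a b d (k + 1))).flatten ++ sturmM a b d k

/-- Denominators `q_k` of the convergents of `θ = [0; 1 + d₁, d₂, d₃, …]`. -/
def cfQ (d : ℕ → ℕ) : ℕ → ℕ
  | 0 => 1
  | 1 => 1 + d 1
  | k + 2 => d (k + 2) * cfQ d (k + 1) + cfQ d k

/-- Numerators `p_k` of the convergents of `θ = [0; 1 + d₁, d₂, d₃, …]`. -/
def cfP (d : ℕ → ℕ) : ℕ → ℕ
  | 0 => 0
  | 1 => 1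
  | k + 2 => d (k + 2) * cfP d (k + 1) + cfP d k

/-- `w` is ultimately periodic (so that `[0; w 1, w 2, …]` is a quadratic irrational). -/
def UltimatelyPeriodic (w : ℕ → ℕ) : Prop :=
  ∃ r s : ℕ, 0 < s ∧ ∀ n, r < n → w (n + s) = w n

end

/-- The product of the matrices `[[c, 1], [1, 0]]` over the letters `c` of a word. -/
def wordMat (L : List ℕ) : Matrix (Fin 2) (Fin 2) ℕ := (L.map fun c => !![c, 1; 1, 0]).prod

/-- The logarithm of the continuant of a word. -/
noncomputable def logK (L : List ℕ) : ℝ := Real.log (wordMat L 0 0)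

/-- The factor of length `n` of the sequence `w` following the letter `w m`. -/
def seg (w : ℕ → ℕ) (m n : ℕ) : List ℕ := (List.range n).map fun j => w (m + j + 1)

/-- The `n`-th power of a word. -/
def wordPow (u : List ℕ) (n : ℕ) : List ℕ := (List.replicate n u).flatten

/-- All letters of the word are positive. -/
def PosWord (L : List ℕ) : Prop := ∀ c ∈ L, 1 ≤ c

lemma wordMat_append (u v : List ℕ) : wordMat (u ++ v) = wordMat u * wordMat v := by
  simp [wordMat]

lemma PosWord.append {u v : List ℕ} (hu : PosWord u) (hv : PosWord v) : PosWord (u ++ v) := by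
  intro c hc
  rcases List.mem_append.1 hc with h | h
  exacts [hu c h, hv c h]

lemma wordMat_bounds {L : List ℕ} (hL : PosWord L) :
    1 ≤ wordMat L 0 0 ∧ wordMat L 0 1 ≤ wordMat L 0 0 ∧ wordMat L 1 0 ≤ wordMat L 0 0 := by
  suffices wordMat L = 1 ∨ (1 ≤ wordMat L 0 0 ∧ wordMat L 0 1 ≤ wordMat L 0 0 ∧
      wordMat L 1 0 ≤ wordMat L 0 0 ∧ wordMat L 1 1 ≤ wordMat L 1 0) by
    rcases this with h | ⟨h1, h2, h3, -⟩
    · simp [h]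
    · exact ⟨h1, h2, h3⟩
  induction L with
  | nil => left; simp [wordMat]
  | cons c L ih =>
    right
    have hc : 1 ≤ c := hL c (by simp)
    have e : wordMat (c :: L) = !![c, 1; 1, 0] * wordMat L := by simp [wordMat]
    rw [e]
    rcases ih (fun x hx => hL x (by simp [hx])) with h1 | ⟨h1, h2, h3, h4⟩
    · rw [h1]; simp [Matrix.mul_apply, Fin.sum_univ_two]; omega
    · simp only [Matrix.mul_apply, Fin.sum_univ_two]
      simp
      refine ⟨by nlinarith, by nlinarith, by nlinarith, by omega⟩

lemma logK_nonneg (L : List ℕ) : 0 ≤ logK L := Real.log_natCast_nonneg _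

lemma logK_nil : logK [] = 0 := by simp [logK, wordMat]

lemma logK_append_ge {u v : List ℕ} (hu : PosWord u) (hv : PosWord v) :
    logK u + logK v ≤ logK (u ++ v) := by
  have h1 := (wordMat_bounds hu).1
  have h2 := (wordMat_bounds hv).1
  unfold logK
  rw [← Real.log_mul (by positivity) (by positivity)]
  apply Real.log_le_log (by positivity)
  rw [wordMat_append, Matrix.mul_apply, Fin.sum_univ_two]
  push_cast
  have : (0 : ℝ) ≤ (wordMat u 0 1 : ℝ) * (wordMat v 1 0 : ℝ) := by positivity
  linarith

lemma logK_append_le {u v : List ℕ} (hu : PosWord u) (hv : PosWord v) :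
    logK (u ++ v) ≤ logK u + logK v + Real.log 2 := by
  obtain ⟨h1, h1', -⟩ := wordMat_bounds hu
  obtain ⟨h2, -, h2'⟩ := wordMat_bounds hv
  have h3 := (wordMat_bounds (hu.append hv)).1
  unfold logK
  rw [← Real.log_mul (by positivity) (by positivity),
    ← Real.log_mul (by positivity) (by positivity)]
  apply Real.log_le_log (by positivity)
  rw [wordMat_append, Matrix.mul_apply, Fin.sum_univ_two]
  have := Nat.mul_le_mul h1' h2'
  exact_mod_cast (by omega : wordMat u 0 0 * wordMat v 0 0 + wordMat u 0 1 * wordMat v 1 0 ≤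
    wordMat u 0 0 * wordMat v 0 0 * 2)

lemma logK_le_of_letters_le {A : ℕ} {L : List ℕ} (hL : PosWord L) (hA : ∀ c ∈ L, c ≤ A) :
    logK L ≤ L.length * Real.log (2 * A) := by
  induction L with
  | nil => simp [logK_nil]
  | cons c L ih =>
    have hc1 : 1 ≤ c := hL c (by simp)
    have hcA : c ≤ A := hA c (by simp)
    have h1 : PosWord [c] := by intro x hx; simp at hx; omega
    have h2 : PosWord L := fun x hx => hL x (by simp [hx])
    have h := logK_append_le h1 h2
    have h3 := ih h2 (fun x hx => hA x (by simp [hx]))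
    have h4 : logK [c] ≤ Real.log A := by
      simp only [logK, wordMat]
      apply Real.log_le_log <;> simp <;> omega
    have h5 : Real.log (2 * A) = Real.log 2 + Real.log A :=
      Real.log_mul (by norm_num) (by norm_cast; omega)
    simp only [List.singleton_append] at h
    rw [List.length_cons]
    push_cast
    linarith

lemma length_seg (w : ℕ → ℕ) (m n : ℕ) : (seg w m n).length = n := by simp [seg]

lemma seg_add (w : ℕ → ℕ) (m n k : ℕ) : seg w m (n + k) = seg w m n ++ seg w (m + n) k := by
  simp [seg, List.range_add, Function.comp_def, add_assoc]

lemma mem_seg {w : ℕ → ℕ} {m n c : ℕ} (h : c ∈ seg w m n) : ∃ i, w i = c := by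
  simp only [seg, List.mem_map] at h
  obtain ⟨j, -, h⟩ := h
  exact ⟨_, h⟩

lemma contQ_eq_wordMat (w : ℕ → ℕ) (n : ℕ) :
    contQ w n = wordMat (seg w 0 n) 0 0 ∧ contQ w (n + 1) = wordMat (seg w 0 (n + 1)) 0 0 := by
  have step : ∀ n, wordMat (seg w 0 (n + 1)) =
      wordMat (seg w 0 n) * !![w (n + 1), 1; 1, 0] := by
    intro n
    rw [seg_add, wordMat_append]
    simp [seg, wordMat]
  induction n with
  | zero => simp [contQ, seg, wordMat]
  | succ n ih =>
    refine ⟨ih.2, ?_⟩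
    rw [step (n + 1)]
    have h1 : wordMat (seg w 0 (n + 1)) 0 1 = wordMat (seg w 0 n) 0 0 := by
      rw [step n]; simp [Matrix.mul_apply, Fin.sum_univ_two]
    simp only [contQ, Matrix.mul_apply, Fin.sum_univ_two]
    simp [h1, ih.1, ih.2, mul_comm]

lemma log_contQ (w : ℕ → ℕ) (n : ℕ) : Real.log (contQ w n) = logK (seg w 0 n) := by
  rw [(contQ_eq_wordMat w n).1, logK]

/-- The word `u` has Lévy exponent `ℓ` up to `ε`, and is long compared with `1 / ε`. -/
def NearExponent (ℓ ε : ℝ) (u : List ℕ) : Prop :=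
  Real.log 2 ≤ ε * u.length ∧ |logK u - ℓ * u.length| ≤ ε * u.length

/-- The sequence `w` is a concatenation of copies of the words `u` and `v`. -/
def IsConcat (w : ℕ → ℕ) (u v : List ℕ) : Prop :=
  ∃ S : ℕ → Prop, S 0 ∧ ∀ m, S m →
    (seg w m u.length = u ∧ S (m + u.length)) ∨ (seg w m v.length = v ∧ S (m + v.length))

lemma exists_cut_near {w : ℕ → ℕ} {ℓ ε : ℝ} {u v : List ℕ} (hw : ∀ n, 1 ≤ w n)
    (hu : NearExponent ℓ ε u) (hv : NearExponent ℓ ε v) (h : IsConcat w u v) (n : ℕ) :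
    ∃ m ≤ n, n < m + (u.length + v.length) ∧
      |logK (seg w 0 m) - ℓ * m| ≤ 2 * ε * m := by
  obtain ⟨S, S0, hS⟩ := h
  have hpos : ∀ m k, PosWord (seg w m k) := by
    intro m k c hc
    obtain ⟨i, rfl⟩ := mem_seg hc
    exact hw i
  have hlen : ∀ {t : List ℕ}, NearExponent ℓ ε t → 0 < t.length := by
    intro t ht
    by_contra h0
    have : t.length = 0 := by omega
    have h1 := ht.1
    rw [this] at h1
    have := Real.log_pos (by norm_num : (1 : ℝ) < 2)
    simp at h1
    linarith
  have hext : ∀ {t : List ℕ} {m : ℕ}, NearExponent ℓ ε t → seg w m t.length = t →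
      |logK (seg w 0 m) - ℓ * m| ≤ 2 * ε * m →
      |logK (seg w 0 (m + t.length)) - ℓ * ((m + t.length : ℕ) : ℝ)| ≤
        2 * ε * ((m + t.length : ℕ) : ℝ) := by
    intro t m ht hseg hm
    have h1 := logK_append_ge (hpos 0 m) (hpos m t.length)
    have h2 := logK_append_le (hpos 0 m) (hpos m t.length)
    have h3 := seg_add w 0 m t.length
    rw [Nat.zero_add] at h3
    rw [← h3, hseg] at h1 h2
    obtain ⟨h4, h5⟩ := ht
    have := Real.log_pos (by norm_num : (1 : ℝ) < 2)
    rw [abs_le] at h5 hm ⊢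
    push_cast
    constructor <;> linarith [h5.1, h5.2, hm.1, hm.2]
  have hu0 := hlen hu
  have hv0 := hlen hv
  suffices ∃ m ≤ n, n < m + (u.length + v.length) ∧ S m ∧
      |logK (seg w 0 m) - ℓ * m| ≤ 2 * ε * m by
    obtain ⟨m, h1, h2, -, h3⟩ := this
    exact ⟨m, h1, h2, h3⟩
  induction n with
  | zero => exact ⟨0, le_rfl, by omega, S0, by simp [seg, logK_nil]⟩
  | succ n ih =>
    obtain ⟨m, h1, h2, h3, h4⟩ := ih
    by_cases hn : n + 1 < m + (u.length + v.length)
    · exact ⟨m, by omega, hn, h3, h4⟩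
    · rcases hS m h3 with ⟨h5, h6⟩ | ⟨h5, h6⟩
      · exact ⟨m + u.length, by omega, by omega, h6, hext hu h5 h4⟩
      · exact ⟨m + v.length, by omega, by omega, h6, hext hv h5 h4⟩

theorem hasLevyConstant_of_isConcat {w : ℕ → ℕ} {ℓ : ℝ} {A : ℕ} (hw : ∀ n, 1 ≤ w n)
    (hA : ∀ n, w n ≤ A)
    (h : ∀ ε > 0, ∃ u v, NearExponent ℓ ε u ∧ NearExponent ℓ ε v ∧ IsConcat w u v) :
    HasLevyConstant w ℓ := by
  have hpos : ∀ m k, PosWord (seg w m k) := by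
    intro m k c hc
    obtain ⟨i, rfl⟩ := mem_seg hc
    exact hw i
  rw [HasLevyConstant, Metric.tendsto_atTop]
  intro ε hε
  obtain ⟨u, v, hu, hv, hc⟩ := h (ε / 4) (by positivity)
  set B := u.length + v.length
  have hA1 : 1 ≤ A := (hw 0).trans (hA 0)
  have hlA : 0 ≤ Real.log (2 * A) :=
    Real.log_nonneg (by norm_cast; omega)
  have hl2 := Real.log_pos (by norm_num : (1 : ℝ) < 2)
  set C : ℝ := Real.log 2 + B * Real.log (2 * A) + |ℓ| * B
  obtain ⟨N, hN⟩ := exists_nat_gt (C / (ε / 4))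
  have hC : C < ε / 4 * N := by
    rw [div_lt_iff₀ (by positivity)] at hN; linarith
  refine ⟨N + 1, fun n hn => ?_⟩
  obtain ⟨m, hmn, hnm, hm⟩ := exists_cut_near hw hu hv hc n
  obtain ⟨k, rfl⟩ := Nat.exists_eq_add_of_le hmn
  have hkB : (k : ℝ) ≤ B := by norm_cast; omega
  have hk0 : (0 : ℝ) ≤ k := by positivity
  have h1 := logK_append_ge (hpos 0 m) (hpos m k)
  have h2 := logK_append_le (hpos 0 m) (hpos m k)
  have h3 := seg_add w 0 m k
  rw [Nat.zero_add] at h3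
  rw [← h3] at h1 h2
  have h4 := logK_nonneg (seg w m k)
  have h5 := logK_le_of_letters_le (hpos m k) (A := A)
    (by intro c hc; obtain ⟨i, rfl⟩ := mem_seg hc; exact hA i)
  rw [length_seg] at h5
  have h6 : (k : ℝ) * Real.log (2 * A) ≤ B * Real.log (2 * A) := by gcongr
  have h7 : |ℓ * k| ≤ |ℓ| * B := by
    rw [abs_mul, abs_of_nonneg hk0]; gcongr
  have hn0 : (0 : ℝ) < ((m + k : ℕ) : ℝ) := by norm_cast; omega
  have hNn : (N : ℝ) ≤ ((m + k : ℕ) : ℝ) := by norm_cast; omega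
  have h8 : ε / 4 * N ≤ ε / 4 * ((m + k : ℕ) : ℝ) := by gcongr
  rw [Real.dist_eq, log_contQ]
  have : logK (seg w 0 (m + k)) / ((m + k : ℕ) : ℝ) - ℓ =
      (logK (seg w 0 (m + k)) - ℓ * ((m + k : ℕ) : ℝ)) / ((m + k : ℕ) : ℝ) := by
    field_simp
  rw [this, abs_div, abs_of_pos hn0, div_lt_iff₀ hn0]
  rw [abs_le] at hm h7
  push_cast at h8 hn0 ⊢
  have h9 : 0 ≤ ε * k := by positivity
  have h10 : 0 ≤ |ℓ| * B := by positivity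
  have h11 : 0 ≤ (B : ℝ) * Real.log (2 * A) := by positivity
  rw [abs_lt]
  constructor <;> nlinarith [hm.1, hm.2, h7.1, h7.2]

lemma wordPow_succ (u : List ℕ) (n : ℕ) : wordPow u (n + 1) = u ++ wordPow u n := by
  simp [wordPow, List.replicate_succ]

lemma wordPow_add (u : List ℕ) (m n : ℕ) :
    wordPow u (m + n) = wordPow u m ++ wordPow u n := by
  rw [wordPow, List.replicate_add, List.flatten_append, wordPow, wordPow]

lemma wordPow_one (u : List ℕ) : wordPow u 1 = u := by simp [wordPow]

lemma wordPow_mul (u : List ℕ) (n j : ℕ) : wordPow u (n * j) = wordPow (wordPow u n) j := by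
  induction j with
  | zero => simp [wordPow]
  | succ j ih => rw [Nat.mul_succ, add_comm, wordPow_add, ih, wordPow_succ]

lemma length_wordPow (u : List ℕ) (n : ℕ) : (wordPow u n).length = n * u.length := by
  simp [wordPow]

lemma PosWord.wordPow {u : List ℕ} (hu : PosWord u) (n : ℕ) : PosWord (wordPow u n) := by
  intro c hc
  simp only [_root_.wordPow, List.mem_flatten, List.mem_replicate] at hc
  obtain ⟨l, ⟨-, rfl⟩, h⟩ := hc
  exact hu c h

lemma logK_wordPow_ge {u : List ℕ} (hu : PosWord u) (n : ℕ) :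
    n * logK u ≤ logK (wordPow u n) := by
  induction n with
  | zero => simpa using logK_nonneg _
  | succ n ih =>
    have := logK_append_ge hu (hu.wordPow n)
    rw [wordPow_succ]
    push_cast
    linarith

lemma logK_wordPow_le {u : List ℕ} (hu : PosWord u) (n : ℕ) :
    logK (wordPow u n) ≤ n * (logK u + Real.log 2) := by
  induction n with
  | zero => simp [wordPow, logK_nil]
  | succ n ih =>
    have := logK_append_le hu (hu.wordPow n)
    rw [wordPow_succ]
    push_cast
    linarith

/-- The sequence `w` with `w 1 w 2 ⋯ = u u u ⋯`. -/
def periodicSeq (u : List ℕ) (n : ℕ) : ℕ := u.getD ((n - 1) % u.length) 1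

lemma periodicSeq_ultimatelyPeriodic {u : List ℕ} (hu : 0 < u.length) :
    UltimatelyPeriodic (periodicSeq u) := by
  refine ⟨0, u.length, hu, fun n hn => ?_⟩
  have : n + u.length - 1 = n - 1 + u.length := by omega
  simp [periodicSeq, this]

lemma periodicSeq_mem {u : List ℕ} (hu : 0 < u.length) (n : ℕ) : periodicSeq u n ∈ u := by
  have h := Nat.mod_lt (n - 1) hu
  rw [periodicSeq, List.getD_eq_getElem _ _ h]
  exact List.getElem_mem h

lemma seg_periodicSeq (u : List ℕ) (m k : ℕ) (hm : u.length ∣ m) :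
    seg (periodicSeq u) m (k * u.length) = wordPow u k := by
  induction k generalizing m with
  | zero => simp [seg, wordPow]
  | succ k ih =>
    rw [Nat.succ_mul, add_comm, seg_add, wordPow_succ, ih _ (hm.add dvd_rfl)]
    congr 1
    apply List.ext_getElem
    · simp [length_seg]
    · intro i h1 h2
      obtain ⟨c, rfl⟩ := hm
      simp [seg, periodicSeq, Nat.mod_eq_of_lt h2, h2]

lemma hasLevyConstant_periodicSeq {u : List ℕ} {ℓ : ℝ} (hu : PosWord u) (hu0 : 0 < u.length)
    (h : ∀ ε > 0, ∃ k, NearExponent ℓ ε (wordPow u k)) : HasLevyConstant (periodicSeq u) ℓ := by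
  refine hasLevyConstant_of_isConcat (A := u.sum) (fun n => hu _ (periodicSeq_mem hu0 n))
    (fun n => List.le_sum_of_mem (periodicSeq_mem hu0 n)) fun ε hε => ?_
  obtain ⟨k, hk⟩ := h ε hε
  refine ⟨_, _, hk, hk, fun m => u.length ∣ m, dvd_zero _, fun m hm => Or.inl ?_⟩
  rw [length_wordPow]
  exact ⟨seg_periodicSeq u m k hm, hm.add (dvd_mul_left _ _)⟩

/-- The periodic sequence `u u u ⋯` has Lévy constant at most `ℓ`. -/
def LowExponent (ℓ : ℝ) (u : List ℕ) : Prop :=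
  ∀ n : ℕ, logK (wordPow u n) ≤ ℓ * (n * u.length)

lemma LowExponent.logK_le {ℓ : ℝ} {u : List ℕ} (h : LowExponent ℓ u) :
    logK u ≤ ℓ * u.length := by
  simpa [wordPow_one] using h 1

lemma le_logK_of_not_lowExponent {ℓ : ℝ} {u : List ℕ} (hu : PosWord u)
    (h : ¬ LowExponent ℓ u) : ℓ * u.length ≤ logK u + Real.log 2 := by
  simp only [LowExponent, not_forall, not_le] at h
  obtain ⟨n, hn⟩ := h
  have h1 := hn.trans_le (logK_wordPow_le hu n)
  by_contra! h2
  have h3 : (n : ℝ) * (logK u + Real.log 2) ≤ n * (ℓ * u.length) := by gcongr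
  linarith

/-- The pairs of words `(U k, V k)` describe successive Farey intervals, the left endpoints
having Lévy constant at most `ℓ` and the right endpoints larger than `ℓ`. -/
structure IsBisection (ℓ : ℝ) (b : ℕ) (U V : ℕ → List ℕ) : Prop where
  left_zero : U 0 = [1]
  right_zero : V 0 = [b]
  step : ∀ k, (U (k + 1) = U k ++ V k ∧ V (k + 1) = V k) ∨
    (U (k + 1) = U k ∧ V (k + 1) = U k ++ V k)
  low : ∀ k, LowExponent ℓ (U k)
  high : ∀ k, ¬ LowExponent ℓ (V k)

lemma exists_isBisection {ℓ : ℝ} {b : ℕ} (h1 : LowExponent ℓ [1]) (hb : ¬ LowExponent ℓ [b]) :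
    ∃ U V, IsBisection ℓ b U V := by
  classical
  let f : List ℕ × List ℕ → List ℕ × List ℕ := fun s =>
    if LowExponent ℓ (s.1 ++ s.2) then (s.1 ++ s.2, s.2) else (s.1, s.1 ++ s.2)
  let s : ℕ → List ℕ × List ℕ := fun k => f^[k] ([1], [b])
  have hs : ∀ k, s (k + 1) = f (s k) := fun k => Function.iterate_succ_apply' f k _
  have key : ∀ k, LowExponent ℓ (s k).1 ∧ ¬ LowExponent ℓ (s k).2 := by
    intro k
    induction k with
    | zero => exact ⟨h1, hb⟩
    | succ k ih =>
      rw [hs]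
      by_cases h : LowExponent ℓ ((s k).1 ++ (s k).2)
      · simpa [f, h] using ih.2
      · simpa [f, h] using ih.1
  refine ⟨fun k => (s k).1, fun k => (s k).2, rfl, rfl, fun k => ?_, fun k => (key k).1,
    fun k => (key k).2⟩
  simp only [hs]
  by_cases h : LowExponent ℓ ((s k).1 ++ (s k).2)
  · left; simp [f, h]
  · right; simp [f, h]

lemma eventually_le_mul_of_increments {D L M : ℕ → ℝ} {c : ℝ}
    (h : ∀ k, (D (k + 1) ≤ D k + c ∧ L k + M k ≤ L (k + 1)) ∨
      (D (k + 1) ≤ D k ∧ L k ≤ L (k + 1)))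
    (hM : Tendsto M atTop atTop) (hL : Tendsto L atTop atTop) {ε : ℝ} (hε : 0 < ε) :
    ∀ᶠ k in atTop, D k ≤ ε * L k := by
  obtain ⟨K, hK⟩ := eventually_atTop.1 (hM.eventually_ge_atTop (c / (ε / 2)))
  have key : ∀ k ≥ K, D k - ε / 2 * L k ≤ D K - ε / 2 * L K := by
    intro k hk
    induction k, hk using Nat.le_induction with
    | base => rfl
    | succ k hk ih =>
      have h1 := hK k hk
      rw [div_le_iff₀ (by positivity)] at h1
      rcases h k with ⟨h2, h3⟩ | ⟨h2, h3⟩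
      · nlinarith
      · nlinarith
  filter_upwards [eventually_ge_atTop K,
    hL.eventually_ge_atTop ((D K - ε / 2 * L K) / (ε / 2))] with k h1 h2
  rw [div_le_iff₀ (by positivity)] at h2
  linarith [key k h1]

lemma tendsto_atTop_of_frequently_lt {f : ℕ → ℕ} (hf : Monotone f)
    (h : ∃ᶠ k in atTop, f k < f (k + 1)) : Tendsto f atTop atTop := by
  refine tendsto_atTop_atTop_of_monotone hf fun N => ?_
  induction N with
  | zero => exact ⟨0, Nat.zero_le _⟩
  | succ N ih =>
    obtain ⟨K, hK⟩ := ih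
    obtain ⟨k, hk, h1⟩ := frequently_atTop.1 h K
    exact ⟨k + 1, (hK.trans (hf hk)).trans_lt h1⟩

namespace IsBisection

variable {ℓ : ℝ} {b : ℕ} {U V : ℕ → List ℕ}

lemma length_pos (h : IsBisection ℓ b U V) (k : ℕ) : 0 < (U k).length ∧ 0 < (V k).length := by
  induction k with
  | zero => simp [h.left_zero, h.right_zero]
  | succ k ih =>
    rcases h.step k with ⟨h1, h2⟩ | ⟨h1, h2⟩ <;> rw [h1, h2] <;>
      simp only [List.length_append] <;> omega

lemma posWord (h : IsBisection ℓ b U V) (hb : 1 ≤ b) (k : ℕ) :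
    PosWord (U k) ∧ PosWord (V k) := by
  induction k with
  | zero => simp [h.left_zero, h.right_zero, PosWord, hb]
  | succ k ih =>
    rcases h.step k with ⟨h1, h2⟩ | ⟨h1, h2⟩ <;> rw [h1, h2]
    exacts [⟨ih.1.append ih.2, ih.2⟩, ⟨ih.1, ih.1.append ih.2⟩]

lemma det_eq_one (h : IsBisection ℓ b U V) (hb : b ≠ 1) (k : ℕ) :
    (U k).length * (V k).count b = (V k).length * (U k).count b + 1 := by
  induction k with
  | zero => simp [h.left_zero, h.right_zero, hb.symm]
  | succ k ih =>
    rcases h.step k with ⟨h1, h2⟩ | ⟨h1, h2⟩ <;> rw [h1, h2] <;>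
      simp only [List.length_append, List.count_append] <;> nlinarith

lemma tendsto_length_left (h : IsBisection ℓ b U V)
    (hf : ∃ᶠ k in atTop, U (k + 1) = U k ++ V k) :
    Tendsto (fun k => (U k).length) atTop atTop := by
  refine tendsto_atTop_of_frequently_lt (monotone_nat_of_le_succ fun k => ?_)
    (hf.mono fun k hk => ?_)
  · rcases h.step k with ⟨h1, -⟩ | ⟨h1, -⟩ <;> simp [h1]
  · simpa [hk] using (h.length_pos k).2

lemma tendsto_length_right (h : IsBisection ℓ b U V)
    (hf : ∃ᶠ k in atTop, V (k + 1) = U k ++ V k) :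
    Tendsto (fun k => (V k).length) atTop atTop := by
  refine tendsto_atTop_of_frequently_lt (monotone_nat_of_le_succ fun k => ?_)
    (hf.mono fun k hk => ?_)
  · rcases h.step k with ⟨-, h1⟩ | ⟨-, h1⟩ <;> simp [h1]
  · simpa [hk] using (h.length_pos k).1

lemma exists_nearExponent (h : IsBisection ℓ b U V) (hb : 1 ≤ b)
    (hU : Tendsto (fun k => (U k).length) atTop atTop)
    (hV : Tendsto (fun k => (V k).length) atTop atTop) {ε : ℝ} (hε : 0 < ε) :
    ∃ k, NearExponent ℓ ε (U k) ∧ NearExponent ℓ ε (V k) := by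
  have hU' : Tendsto (fun k => ((U k).length : ℝ)) atTop atTop :=
    tendsto_natCast_atTop_atTop.comp hU
  have hV' : Tendsto (fun k => ((V k).length : ℝ)) atTop atTop :=
    tendsto_natCast_atTop_atTop.comp hV
  have hl2 := Real.log_pos (by norm_num : (1 : ℝ) < 2)
  have e1 : ∀ᶠ k in atTop, ℓ * (U k).length - logK (U k) ≤ ε * (U k).length := by
    refine eventually_le_mul_of_increments (D := fun k => ℓ * (U k).length - logK (U k))
      (c := Real.log 2) (fun k => ?_) hV' hU' hε
    rcases h.step k with ⟨h1, -⟩ | ⟨h1, -⟩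
    · left
      have h2 := logK_append_ge (h.posWord hb k).1 (h.posWord hb k).2
      have h3 := le_logK_of_not_lowExponent (h.posWord hb k).2 (h.high k)
      rw [h1, List.length_append]
      push_cast
      constructor <;> linarith
    · right; simp [h1]
  have e2 : ∀ᶠ k in atTop, logK (V k) - ℓ * (V k).length ≤ ε * (V k).length := by
    refine eventually_le_mul_of_increments (D := fun k => logK (V k) - ℓ * (V k).length)
      (c := Real.log 2) (fun k => ?_) hU' hV' hε
    rcases h.step k with ⟨-, h1⟩ | ⟨-, h1⟩
    · right; simp [h1]
    · left
      have h2 := logK_append_le (h.posWord hb k).1 (h.posWord hb k).2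
      have h3 := (h.low k).logK_le
      rw [h1, List.length_append]
      push_cast
      constructor <;> linarith
  obtain ⟨k, h1, h2, h3, h4⟩ := (e1.and (e2.and
    ((hU'.eventually_ge_atTop (Real.log 2 / ε)).and
      (hV'.eventually_ge_atTop (Real.log 2 / ε))))).exists
  rw [div_le_iff₀ hε] at h3 h4
  have h5 := (h.low k).logK_le
  have h6 := le_logK_of_not_lowExponent (h.posWord hb k).2 (h.high k)
  refine ⟨k, ⟨by linarith, ?_⟩, ⟨by linarith, ?_⟩⟩ <;> rw [abs_le] <;>
    constructor <;> linarith

lemma exists_nearExponent_wordPow (h : IsBisection ℓ b U V) (hb : 1 ≤ b) {K : ℕ}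
    (hK : ∀ k ≥ K, U (k + 1) = U k ∧ V (k + 1) = U k ++ V k) {ε : ℝ} (hε : 0 < ε) :
    ∃ j, NearExponent ℓ ε (wordPow (U K) j) := by
  have key : ∀ j, U (K + j) = U K ∧ V (K + j) = wordPow (U K) j ++ V K := by
    intro j
    induction j with
    | zero => simp [wordPow]
    | succ j ih =>
      obtain ⟨h1, h2⟩ := hK (K + j) (by omega)
      rw [← add_assoc, h1, h2, ih.1, ih.2, wordPow_succ]
      simp
  obtain ⟨hU, hV⟩ := h.posWord hb K
  have hl2 := Real.log_pos (by norm_num : (1 : ℝ) < 2)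
  set C := logK (V K) + 2 * Real.log 2 - ℓ * (V K).length
  obtain ⟨j, hj⟩ := exists_nat_gt (max (C / ε) (Real.log 2 / ε))
  rw [max_lt_iff, div_lt_iff₀ hε, div_lt_iff₀ hε] at hj
  have h0 : (1 : ℝ) ≤ (U K).length := by exact_mod_cast (h.length_pos K).1
  have h1 : (j : ℝ) * ε ≤ ε * (j * (U K).length) := by
    have : 0 ≤ (j : ℝ) * ε := by positivity
    nlinarith
  have h2 := le_logK_of_not_lowExponent (h.posWord hb _).2 (h.high (K + j))
  have h3 := logK_append_le (hU.wordPow j) hV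
  have h4 := h.low K j
  rw [(key j).2, List.length_append, length_wordPow] at h2
  push_cast at h2
  have h5 : 0 ≤ ε * (j * (U K).length) := by positivity
  refine ⟨j, ?_, ?_⟩ <;> rw [length_wordPow] <;> push_cast
  · linarith [hj.2]
  · rw [abs_le]
    constructor <;> linarith [hj.1]

lemma frequently_right (h : IsBisection ℓ b U V) (hb : 1 ≤ b) :
    ∃ᶠ k in atTop, V (k + 1) = U k ++ V k := by
  by_contra hf
  rw [not_frequently, eventually_atTop] at hf
  obtain ⟨K, hK⟩ := hf
  have key : ∀ j, U (K + j) = U K ++ wordPow (V K) j ∧ V (K + j) = V K := by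
    intro j
    induction j with
    | zero => simp [wordPow]
    | succ j ih =>
      have h1 := (h.step (K + j)).resolve_right fun h2 => hK _ (by omega) h2.2
      rw [← add_assoc, h1.1, h1.2, ih.1, ih.2, wordPow_add, wordPow_one]
      simp
  obtain ⟨hU, hV⟩ := h.posWord hb K
  have hv := h.high K
  simp only [LowExponent, not_forall, not_le] at hv
  obtain ⟨n, hn⟩ := hv
  set η := logK (wordPow (V K) n) - ℓ * (n * (V K).length) with hη
  have hη0 : 0 < η := by linarith
  obtain ⟨j, hj⟩ := exists_nat_gt (ℓ * (U K).length / η)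
  rw [div_lt_iff₀ hη0] at hj
  have h1 := (h.low (K + n * j)).logK_le
  have h2 := logK_append_ge hU (hV.wordPow (n * j))
  have h3 := logK_wordPow_ge (hV.wordPow n) j
  have h4 := logK_nonneg (U K)
  rw [← wordPow_mul] at h3
  rw [(key _).1, List.length_append, length_wordPow] at h1
  push_cast at h1
  rw [hη] at hj
  nlinarith

/-- The data of a slope lying strictly inside all the Farey intervals of a bisection. -/
structure IsSlope (b : ℕ) (U V : ℕ → List ℕ) (θ : ℝ) : Prop where
  left : ∀ k, 0 < (U k).length * θ - (U k).count b
  right : ∀ k, 0 < (V k).count b - (V k).length * θ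

lemma exists_weak_slope (h : IsBisection ℓ b U V) (hb : b ≠ 1) :
    ∃ θ : ℝ, ∀ k, 0 ≤ (U k).length * θ - (U k).count b ∧
      0 ≤ (V k).count b - (V k).length * θ := by
  have hu : ∀ k, (0 : ℝ) < (U k).length := fun k => by exact_mod_cast (h.length_pos k).1
  have hv : ∀ k, (0 : ℝ) < (V k).length := fun k => by exact_mod_cast (h.length_pos k).2
  have hd : ∀ k, ((U k).length : ℝ) * (V k).count b = (V k).length * (U k).count b + 1 :=
    fun k => by exact_mod_cast h.det_eq_one hb k
  let f : ℕ → ℝ := fun k => (U k).count b / (U k).length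
  let g : ℕ → ℝ := fun k => (V k).count b / (V k).length
  have hf : Monotone f := by
    refine monotone_nat_of_le_succ fun k => ?_
    rcases h.step k with ⟨h1, -⟩ | ⟨h1, -⟩
    · simp only [f, h1, List.length_append, List.count_append]
      push_cast
      rw [div_le_div_iff₀ (hu k) (add_pos (hu k) (hv k))]
      linarith [hd k]
    · simp [f, h1]
  have hg : Antitone g := by
    refine antitone_nat_of_succ_le fun k => ?_
    rcases h.step k with ⟨-, h1⟩ | ⟨-, h1⟩
    · simp [g, h1]
    · simp only [g, h1, List.length_append, List.count_append]
      push_cast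
      rw [div_le_div_iff₀ (add_pos (hu k) (hv k)) (hv k)]
      linarith [hd k]
  have hfg : f ≤ g := fun k => by
    simp only [f, g]
    rw [div_le_div_iff₀ (hu k) (hv k)]
    linarith [hd k]
  refine ⟨⨆ k, f k, fun k => ?_⟩
  have h1 := Set.mem_iInter.1 (hf.ciSup_mem_iInter_Icc_of_antitone hg hfg) k
  obtain ⟨h2, h3⟩ := h1
  simp only [f] at h2
  simp only [g] at h3
  rw [div_le_iff₀ (hu k)] at h2
  rw [le_div_iff₀ (hv k)] at h3
  constructor <;> linarith

lemma exists_isSlope (h : IsBisection ℓ b U V) (hb : b ≠ 1)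
    (hU : Tendsto (fun k => (U k).length) atTop atTop)
    (hV : Tendsto (fun k => (V k).length) atTop atTop) :
    ∃ θ : ℝ, Irrational θ ∧ IsSlope b U V θ := by
  obtain ⟨θ, hθ⟩ := h.exists_weak_slope hb
  have hirr : Irrational θ := by
    rintro ⟨r, rfl⟩
    obtain ⟨k, hk1, hk2⟩ :=
      ((hU.eventually_gt_atTop r.den).and (hV.eventually_gt_atTop r.den)).exists
    obtain ⟨h1, h2⟩ := hθ k
    have hden : (0 : ℝ) < r.den := by exact_mod_cast r.pos
    have hr : (r : ℝ) * r.den = r.num := by exact_mod_cast Rat.mul_den_eq_num r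
    have hA : (0 : ℤ) ≤ (U k).length * r.num - (U k).count b * r.den := by
      have : (0 : ℝ) ≤ (U k).length * r.num - (U k).count b * r.den := by
        rw [← hr]; nlinarith [mul_nonneg h1 hden.le]
      exact_mod_cast this
    have hB : (0 : ℤ) ≤ (V k).count b * r.den - (V k).length * r.num := by
      have : (0 : ℝ) ≤ (V k).count b * r.den - (V k).length * r.num := by
        rw [← hr]; nlinarith [mul_nonneg h2 hden.le]
      exact_mod_cast this
    have hd : ((U k).length : ℤ) * (V k).count b = (V k).length * (U k).count b + 1 := by
      exact_mod_cast h.det_eq_one hb k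
    set A : ℤ := (U k).length * r.num - (U k).count b * r.den with hAdef
    set B : ℤ := (V k).count b * r.den - (V k).length * r.num with hBdef
    have hsum : ((U k).length : ℤ) * B + (V k).length * A = r.den := by
      rw [hAdef, hBdef]
      linear_combination (r.den : ℤ) * hd
    have hq1 : (r.den : ℤ) < (U k).length := by exact_mod_cast hk1
    have hq2 : (r.den : ℤ) < (V k).length := by exact_mod_cast hk2
    have hs : (0 : ℤ) < r.den := by exact_mod_cast r.pos
    rcases hA.eq_or_lt with hA0 | hA0
    · rcases hB.eq_or_lt with hB0 | hB0
      · rw [← hA0, ← hB0] at hsum; linarith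
      · nlinarith
    · nlinarith
  refine ⟨θ, hirr, fun k => lt_of_le_of_ne (hθ k).1 fun h0 => ?_,
    fun k => lt_of_le_of_ne (hθ k).2 fun h0 => ?_⟩
  · have := (hirr.natCast_mul (h.length_pos k).1.ne').sub_natCast ((U k).count b)
    exact this.ne_zero h0.symm
  · have := (hirr.natCast_mul (h.length_pos k).2.ne').natCast_sub ((V k).count b)
    exact this.ne_zero h0.symm

end IsBisection

lemma mechWord_shift (a b : ℕ) (θ x : ℝ) (m j : ℕ) (i : ℤ) :
    mechWord a b θ x (m + j + 1) = mechWord a b θ (x + m * θ - i) (j + 1) := by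
  have h1 : ((m + j + 1 : ℕ) : ℝ) * θ + x = ((j + 1 : ℕ) : ℝ) * θ + (x + m * θ - i) + i := by
    push_cast; ring
  have h2 : (((m + j + 1 : ℕ) : ℝ) - 1) * θ + x =
      (((j + 1 : ℕ) : ℝ) - 1) * θ + (x + m * θ - i) + i := by
    push_cast; ring
  rw [mechWord, mechWord, h1, h2, Int.floor_add_intCast, Int.floor_add_intCast,
    add_sub_add_right_eq_sub]

lemma seg_mechWord_shift (a b : ℕ) (θ x : ℝ) (m n : ℕ) (i : ℤ) :
    seg (mechWord a b θ x) m n = seg (mechWord a b θ (x + m * θ - i)) 0 n := by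
  simp only [seg, mechWord_shift a b θ x m _ i, Nat.zero_add]

lemma seg_mechWord_eq_append {a b : ℕ} {θ x : ℝ} {u v : List ℕ} (i : ℤ)
    (hu : seg (mechWord a b θ x) 0 u.length = u)
    (hv : seg (mechWord a b θ (x + u.length * θ - i)) 0 v.length = v) :
    seg (mechWord a b θ x) 0 (u ++ v).length = u ++ v := by
  rw [List.length_append, seg_add, hu, Nat.zero_add, seg_mechWord_shift _ _ _ _ _ _ i, hv]

namespace IsBisection

variable {ℓ : ℝ} {b : ℕ} {U V : ℕ → List ℕ} {θ : ℝ}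

lemma slope_mem (h : IsBisection ℓ b U V) (hb : b ≠ 1) (hθ : IsSlope b U V θ) :
    0 < θ ∧ θ < 1 := by
  have h1 := hθ.left 0
  have h2 := hθ.right 0
  simp [h.left_zero, h.right_zero, hb.symm] at h1 h2
  exact ⟨h1, h2⟩

lemma seg_mechWord (h : IsBisection ℓ b U V) (hb : b ≠ 1) (hθ : IsSlope b U V θ) (k : ℕ) :
    (∀ x, 0 ≤ x → x < (V k).count b - (V k).length * θ →
      seg (mechWord 1 b θ x) 0 (U k).length = U k) ∧
    (∀ x, (V k).count b - (V k).length * θ ≤ x →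
      x < ((U k).length * θ - (U k).count b) + ((V k).count b - (V k).length * θ) →
      seg (mechWord 1 b θ x) 0 (V k).length = V k) := by
  induction k with
  | zero =>
    obtain ⟨h1, h2⟩ := h.slope_mem hb hθ
    simp only [h.left_zero, h.right_zero]
    simp [hb.symm, seg, mechWord]
    refine ⟨fun x hx0 hx1 => ?_, fun x hx0 hx1 => ?_⟩
    · have e1 : ⌊θ + x⌋ = 0 := Int.floor_eq_iff.2 ⟨by push_cast; linarith, by push_cast; linarith⟩
      have e2 : ⌊x⌋ = 0 := Int.floor_eq_iff.2 ⟨by push_cast; linarith, by push_cast; linarith⟩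
      simp [e1, e2]
    · have e1 : ⌊θ + x⌋ = 1 := Int.floor_eq_iff.2 ⟨by push_cast; linarith, by push_cast; linarith⟩
      have e2 : ⌊x⌋ = 0 := Int.floor_eq_iff.2 ⟨by push_cast; linarith, by push_cast; linarith⟩
      simp [e1, e2]
  | succ k ih =>
    obtain ⟨ihu, ihv⟩ := ih
    have p1 := hθ.left k
    have p2 := hθ.right k
    have p3 := hθ.left (k + 1)
    have p4 := hθ.right (k + 1)
    have append : ∀ x, 0 ≤ x → x < (V k).count b - (V k).length * θ →
        (V k).count b - (V k).length * θ ≤ x + ((U k).length * θ - (U k).count b) →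
        seg (mechWord 1 b θ x) 0 (U k ++ V k).length = U k ++ V k := by
      intro x hx0 hx1 hx2
      refine seg_mechWord_eq_append ((U k).count b : ℤ) (ihu x hx0 hx1) (ihv _ ?_ ?_) <;>
        push_cast <;> linarith
    rcases h.step k with ⟨h1, h2⟩ | ⟨h1, h2⟩
    · rw [h1, List.length_append, List.count_append] at p3
      push_cast at p3
      rw [h1, h2]
      refine ⟨fun x hx0 hx1 => append x hx0 hx1 (by linarith), fun x hx0 hx1 => ihv x hx0 ?_⟩
      rw [List.length_append, List.count_append] at hx1
      push_cast at hx1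
      linarith
    · rw [h2, List.length_append, List.count_append] at p4
      push_cast at p4
      rw [h1, h2]
      simp only [List.count_append, List.length_append (as := U k) (bs := V k), Nat.cast_add]
      refine ⟨fun x hx0 hx1 => ihu x hx0 (by linarith), fun x hx0 hx1 => ?_⟩
      rw [← List.length_append]
      exact append x (by linarith) (by linarith) (by linarith)

lemma isConcat_mechWord (h : IsBisection ℓ b U V) (hb : b ≠ 1) (hθ : IsSlope b U V θ) (k : ℕ) :
    IsConcat (mechWord 1 b θ 0) (U k) (V k) := by
  obtain ⟨hu, hv⟩ := h.seg_mechWord hb hθ k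
  have p1 := hθ.left k
  have p2 := hθ.right k
  refine ⟨fun m => ∃ i : ℤ, 0 ≤ m * θ - i ∧ m * θ - i <
    ((U k).length * θ - (U k).count b) + ((V k).count b - (V k).length * θ),
    ⟨0, by simp, by simp; linarith⟩, ?_⟩
  rintro m ⟨i, hi0, hi1⟩
  rcases lt_or_ge (m * θ - i) ((V k).count b - (V k).length * θ) with hi | hi
  · left
    rw [seg_mechWord_shift _ _ _ _ _ _ i, zero_add]
    refine ⟨hu _ hi0 hi, i + (U k).count b, ?_, ?_⟩ <;> push_cast <;> linarith
  · right
    rw [seg_mechWord_shift _ _ _ _ _ _ i, zero_add]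
    refine ⟨hv _ hi hi1, i + (V k).count b, ?_, ?_⟩ <;> push_cast <;> linarith

end IsBisection

lemma mechWord_eq_or (a b : ℕ) (θ ρ : ℝ) (n : ℕ) :
    mechWord a b θ ρ n = a ∨ mechWord a b θ ρ n = b := by
  unfold mechWord
  split_ifs <;> simp

lemma lowExponent_one {ℓ : ℝ} (hℓ : Real.log Real.goldenRatio ≤ ℓ) : LowExponent ℓ [1] := by
  have key : ∀ n, wordMat (wordPow [1] n) 0 0 = Nat.fib (n + 1) ∧
      wordMat (wordPow [1] n) 1 0 = Nat.fib n := by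
    intro n
    induction n with
    | zero => simp [wordPow, wordMat]
    | succ n ih =>
      rw [wordPow_succ, wordMat_append, Matrix.mul_apply, Matrix.mul_apply, Fin.sum_univ_two,
        Fin.sum_univ_two, ih.1, ih.2, Nat.fib_add_two]
      simp [wordMat, add_comm]
  intro n
  have hfib : (Nat.fib (n + 1) : ℝ) ≤ Real.goldenRatio ^ n := by
    have h := Real.fib_succ_sub_goldenConj_mul_fib n
    have h' : Real.goldenConj * Nat.fib n ≤ 0 :=
      mul_nonpos_of_nonpos_of_nonneg Real.goldenConj_neg.le (Nat.cast_nonneg _)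
    linarith
  rw [logK, (key n).1]
  have h1 : (0 : ℝ) < Nat.fib (n + 1) := by exact_mod_cast Nat.fib_pos.2 (by omega)
  have h2 := Real.log_le_log h1 hfib
  rw [Real.log_pow] at h2
  have h3 : (n : ℝ) * Real.log Real.goldenRatio ≤ n * ℓ := by gcongr
  simp
  linarith

/-- For every `ℓ ≥ log((1+√5)/2)` there is an irrational number with
Lévy constant `ℓ` whose sequence of partial quotients is either ultimately periodic
(a quadratic irrational) or a Sturmian word (a Sturmian continued fraction). -/
theorem stmt2 (ℓ : ℝ) (hℓ : Real.log ((1 + Real.sqrt 5) / 2) ≤ ℓ) :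
    ∃ w : ℕ → ℕ, (∀ n, 1 ≤ n → 0 < w n) ∧
      (UltimatelyPeriodic w ∨
        ∃ a b : ℕ, 0 < a ∧ 0 < b ∧ a ≠ b ∧ IsSturmianWord a b w) ∧
      HasLevyConstant w ℓ := by
  have hℓ0 : 0 ≤ ℓ := (Real.log_nonneg Real.one_lt_goldenRatio.le).trans hℓ
  obtain ⟨b, hb⟩ := exists_nat_gt (Real.exp ℓ)
  have hb1 : 1 < b := by
    have := (Real.one_le_exp hℓ0).trans_lt hb
    exact_mod_cast this
  have hhigh : ¬ LowExponent ℓ [b] := by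
    intro h
    have h1 := h.logK_le
    have h2 : ℓ < Real.log b := (Real.lt_log_iff_exp_lt (by positivity)).2 hb
    simp [logK, wordMat] at h1
    linarith
  obtain ⟨U, V, h⟩ := exists_isBisection (lowExponent_one hℓ) hhigh
  by_cases hf : ∃ᶠ k in atTop, U (k + 1) = U k ++ V k
  · have hU := h.tendsto_length_left hf
    have hV := h.tendsto_length_right (h.frequently_right hb1.le)
    obtain ⟨θ, hirr, hθ⟩ := h.exists_isSlope hb1.ne' hU hV
    obtain ⟨h0, h1⟩ := h.slope_mem hb1.ne' hθ
    have hw : ∀ n, 1 ≤ mechWord 1 b θ 0 n := fun n => by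
      rcases mechWord_eq_or 1 b θ 0 n with e | e <;> omega
    refine ⟨mechWord 1 b θ 0, fun n _ => hw n, Or.inr ⟨1, b, one_pos, by omega, hb1.ne, θ, 0, hirr,
      ⟨h0.le, h1.le⟩, by simp, Or.inl rfl⟩, hasLevyConstant_of_isConcat (A := b) hw
      (fun n => by rcases mechWord_eq_or 1 b θ 0 n with e | e <;> omega) fun ε hε => ?_⟩
    obtain ⟨k, hk1, hk2⟩ := h.exists_nearExponent hb1.le hU hV hε
    exact ⟨U k, V k, hk1, hk2, h.isConcat_mechWord hb1.ne' hθ k⟩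
  · rw [not_frequently, eventually_atTop] at hf
    obtain ⟨K, hK⟩ := hf
    have hpos := (h.length_pos K).1
    have hU := (h.posWord hb1.le K).1
    refine ⟨periodicSeq (U K), fun n _ => hU _ (periodicSeq_mem hpos n),
      Or.inl (periodicSeq_ultimatelyPeriodic hpos), hasLevyConstant_periodicSeq hU hpos fun ε hε =>
      h.exists_nearExponent_wordPow hb1.le (fun k hk => ?_) hε⟩
    exact (h.step k).resolve_left fun h2 => hK k hk h2.1
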